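/- arXiv:2105.00628 — 2 statements merged into one kernel-verified Lean document; each statement's English description precedes it below -/
import Mathlib

section
/- For all natural numbers a, b, c with c ≥ 1 and 0 < b < a, the extended binomial coefficient satisfies the three-term recurrence ⁽ᶜ⁾C⁽ᵃ⁾_b = ⁽ᶜ⁾C⁽ᵃ⁻¹⁾_{b−1} + ⁽ᶜ⁾C⁽ᵃ⁻¹⁾_b + ⁽ᶜ⁻¹⁾C⁽ᵃ⁾_b. -/
/-- The extended binomial coefficient `⁽ᶜ⁾C⁽ᵃ⁾_b := C(b+c, c) * C(a+c, b+c)`,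
the entry of Pascal's cube. -/
def extC (c a b : ℕ) : ℕ := Nat.choose (b + c) c * Nat.choose (a + c) (b + c)

/-- Interior three-term recurrence of Pascal's cube:
`⁽ᶜ⁾C⁽ᵃ⁾_b = ⁽ᶜ⁾C⁽ᵃ⁻¹⁾_{b-1} + ⁽ᶜ⁾C⁽ᵃ⁻¹⁾_b + ⁽ᶜ⁻¹⁾C⁽ᵃ⁾_b` for `c ≥ 1`, `0 < b < a`. -/
theorem extC_recurrence (a b c : ℕ) (hc : 1 ≤ c) (hb : 0 < b) (hba : b < a) :
    extC c a b = extC c (a - 1) (b - 1) + extC c (a - 1) b + extC (c - 1) a b := by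
  obtain ⟨a, rfl⟩ := Nat.exists_eq_add_of_lt (hb.trans hba)
  obtain ⟨b, rfl⟩ := Nat.exists_eq_add_of_le' hb
  obtain ⟨c, rfl⟩ := Nat.exists_eq_add_of_le' hc
  simp only [extC, zero_add, Nat.add_sub_cancel]
  rw [show a + 1 + (c + 1) = a + (c + 1) + 1 by ring,
    show b + 1 + (c + 1) = b + (c + 1) + 1 by ring,
    show a + 1 + c = a + (c + 1) by ring, show b + 1 + c = b + (c + 1) by ring,
    Nat.choose_succ_succ' (a + (c + 1)), Nat.choose_succ_succ' (b + (c + 1)) c]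
  ring
end

section
/- For all natural numbers a, b, c with c ≥ 1 and b ≤ a, the extended binomial coefficient satisfies the Vandermonde-type convolution ⁽ᶜ⁾C⁽ᵃ⁾_b = ∑_{n=0}^{a} ∑_{m=0}^{b} C(n, m) · ⁽ᶜ⁻¹⁾C⁽ᵃ⁻ⁿ⁾_{b−m}, where the sum runs over pairs (n, m) with 0 ≤ n ≤ a, 0 ≤ m ≤ b, and a term is taken to be zero unless m ≤ n and b − m ≤ a − n. -/
theorem extC_eq_choose_mul_choose (c a b : ℕ) :
    extC c a b = (a + c).choose c * a.choose b := by
  rw [extC, mul_comm, Nat.choose_mul (Nat.le_add_left c b), Nat.add_sub_cancel,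
    Nat.add_sub_cancel]

/-- Vandermonde-type convolution for the extended binomial coefficients:
`⁽ᶜ⁾C⁽ᵃ⁾_b = ∑_{n=0}^{a} ∑_{m=0}^{b} C(n, m) * ⁽ᶜ⁻¹⁾C⁽ᵃ⁻ⁿ⁾_{b-m}` for `c ≥ 1`, `b ≤ a`;
terms with `m > n` or `b - m > a - n` vanish since the corresponding
binomial coefficients are zero. -/
theorem extC_convolution (a b c : ℕ) (hc : 1 ≤ c) (hba : b ≤ a) :
    extC c a b =
      ∑ n ∈ Finset.range (a + 1), ∑ m ∈ Finset.range (b + 1),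
        Nat.choose n m * extC (c - 1) (a - n) (b - m) := by
  obtain ⟨k, rfl⟩ := Nat.exists_eq_add_of_le' hc
  have inner : ∀ n ∈ Finset.range (a + 1),
      ∑ m ∈ Finset.range (b + 1), n.choose m * extC (k + 1 - 1) (a - n) (b - m) =
        (a - n + k).choose k * a.choose b := by
    intro n hn
    have vandermonde := Nat.add_choose_eq n (a - n) b
    rw [Nat.add_sub_cancel' (Finset.mem_range_succ_iff.mp hn),
      Finset.Nat.sum_antidiagonal_eq_sum_range_succ
        (fun i j => n.choose i * (a - n).choose j)] at vandermonde
    rw [vandermonde, Finset.mul_sum]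
    refine Finset.sum_congr rfl fun m _ => ?_
    rw [extC_eq_choose_mul_choose, Nat.add_sub_cancel, mul_left_comm]
  have hockey_stick : ∑ n ∈ Finset.range (a + 1), (a - n + k).choose k =
      (a + (k + 1)).choose (k + 1) := by
    rw [← Finset.sum_range_reflect, ← add_assoc, ← Nat.sum_range_add_choose]
    refine Finset.sum_congr rfl fun n hn => ?_
    congr 2
    have := Finset.mem_range.mp hn
    omega
  rw [Finset.sum_congr rfl inner, ← Finset.sum_mul, hockey_stick, extC_eq_choose_mul_choose]
end
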